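/- arXiv:2109.12362 — 8 statements merged into one kernel-verified Lean document; each statement's English description precedes it below -/
import Mathlib

section
/- Let q be a nonzero real number, let α > 0, let m ≥ 1 be a natural number, and suppose f : ℝ → ℝ satisfies f(x) = (x - α)^m · h(x) for all x in a neighborhood of α, where h : ℝ → ℝ is continuous at α and h(α) ≠ 0 (α is a root of f of multiplicity m). Then α^q is a root of g of multiplicity m: there exists a function H : ℝ → ℝ continuous at α^q with H(α^q) ≠ 0 such that g(t) = (t - α^q)^m · H(t) for all t > 0 in a neighborhood of α^q, where g(t) = f(t^(1/q)). -/
open Real Filter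

/-- A factorization `f x = (x - φ b) ^ m * h x` near `φ b` pulls back along a map `φ`
with nonzero derivative at `b` to a factorization of `f ∘ φ` of the same order near `b`. -/
theorem exists_eventually_comp_eq_pow_mul {𝕜 : Type*} [NontriviallyNormedField 𝕜]
    {f h φ : 𝕜 → 𝕜} {b φ' : 𝕜} {m : ℕ} (hφ : HasDerivAt φ φ' b) (hφ' : φ' ≠ 0)
    (hh : ContinuousAt h (φ b)) (hh0 : h (φ b) ≠ 0)
    (hfh : ∀ᶠ x in nhds (φ b), f x = (x - φ b) ^ m * h x) :
    ∃ H : 𝕜 → 𝕜, ContinuousAt H b ∧ H b ≠ 0 ∧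
      ∀ᶠ t in nhds b, f (φ t) = (t - b) ^ m * H t := by
  refine ⟨fun t => dslope φ b t ^ m * h (φ t), ?_, ?_, ?_⟩
  · exact ((continuousAt_dslope_same.2 hφ.differentiableAt).pow m).mul
      (hh.comp hφ.continuousAt)
  · simp only [dslope_same, hφ.deriv]
    exact mul_ne_zero (pow_ne_zero m hφ') hh0
  · filter_upwards [hφ.continuousAt.eventually hfh] with t ht
    rw [ht, ← sub_smul_dslope φ b t, smul_eq_mul, mul_pow, mul_assoc]

/-- Proposition 2.3 (multiple root case): if `α` is a root of `f` of multiplicity `m`,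
then `α^q` is a root of `g(t) = f(t^(1/q))` of multiplicity `m`. -/
theorem multiple_root_of_rpow_change_of_variable (q α : ℝ) (hq : q ≠ 0) (hα : 0 < α)
    (m : ℕ) (hm : 1 ≤ m) (f h : ℝ → ℝ)
    (hh : ContinuousAt h α) (hh0 : h α ≠ 0)
    (hfh : ∀ᶠ x in nhds α, f x = (x - α) ^ m * h x) :
    ∃ H : ℝ → ℝ, ContinuousAt H (α ^ q) ∧ H (α ^ q) ≠ 0 ∧
      ∀ᶠ t in nhds (α ^ q), 0 < t → f (t ^ (1 / q)) = (t - α ^ q) ^ m * H t := by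
  have hb : 0 < α ^ q := rpow_pos_of_pos hα q
  have hroot : (α ^ q) ^ (1 / q) = α := by
    rw [one_div, rpow_rpow_inv hα.le hq]
  obtain ⟨H, hH, hH0, hfH⟩ := exists_eventually_comp_eq_pow_mul (f := f) (h := h) (m := m)
    (hasDerivAt_rpow_const (p := 1 / q) (Or.inl hb.ne'))
    (mul_ne_zero (one_div_ne_zero hq) (rpow_pos_of_pos hb _).ne')
    (by rwa [hroot]) (by rwa [hroot]) (by rwa [hroot])
  exact ⟨H, hH, hH0, hfH.mono fun _ ht _ => ht⟩
end

section
/- Let f : ℝ → ℝ be twice continuously differentiable on a neighborhood of α, with f(α) = 0 and f'(α) ≠ 0 (α is a simple root). Let N(x) = x - f(x)/f'(x) be the Newton iteration map. Then (N(x) - α)/(x - α)² tends to (1/2)·f''(α)/f'(α) as x tends to α with x ≠ α; in particular Newton's method converges quadratically to a simple root. -/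
open Real Filter Topology

/-- Second-order Taylor expansion in Peano form, as a limit of difference quotients. -/
theorem tendsto_taylor_two_quotient {f : ℝ → ℝ} {α : ℝ}
    (hd : ∀ᶠ x in 𝓝 α, DifferentiableAt ℝ f x) (hd2 : DifferentiableAt ℝ (deriv f) α) :
    Tendsto (fun x => (f x - f α - deriv f α * (x - α)) / (x - α) ^ 2) (𝓝[≠] α)
      (𝓝 (deriv (deriv f) α / 2)) := by
  have hslope := hasDerivAt_iff_tendsto_slope.1 hd2.hasDerivAt
  have hcont : ContinuousAt f α := hd.self_of_nhds.continuousAt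
  refine HasDerivAt.lhopital_zero_nhdsNE (f' := fun x => deriv f x - deriv f α)
    (g' := fun x => 2 * (x - α)) ?_ ?_ ?_ ?_ ?_ ?_
  · filter_upwards [hd.filter_mono nhdsWithin_le_nhds] with x hx
    simpa using (hx.hasDerivAt.sub_const (f α)).fun_sub
      (((hasDerivAt_id x).sub_const α).const_mul (deriv f α))
  · refine Eventually.of_forall fun x => ?_
    simpa using ((hasDerivAt_id x).sub_const α).fun_pow 2
  · filter_upwards [self_mem_nhdsWithin] with x hx
    exact mul_ne_zero two_ne_zero (sub_ne_zero.2 hx)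
  · have h : ContinuousAt (fun x => f x - f α - deriv f α * (x - α)) α := by fun_prop
    simpa using h.tendsto.mono_left nhdsWithin_le_nhds
  · have h : ContinuousAt (fun x : ℝ => (x - α) ^ 2) α := by fun_prop
    simpa using h.tendsto.mono_left nhdsWithin_le_nhds
  · refine (hslope.div_const 2).congr fun x => ?_
    rw [slope_def_field, div_div, mul_comm]

/-- Theorem 3.2 (simple root): Newton's method converges quadratically to a simple
root `α`, with `(N(x) - α)/(x - α)² → (1/2)·f''(α)/f'(α)` where `N(x) = x - f(x)/f'(x)`. -/
theorem newton_quadratic_convergence_simple_root (α : ℝ) (f : ℝ → ℝ) (s : Set ℝ)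
    (hs : s ∈ nhds α) (hf : ContDiffOn ℝ 2 f s)
    (hroot : f α = 0) (hf' : deriv f α ≠ 0) :
    Tendsto (fun x : ℝ => ((x - f x / deriv f x) - α) / (x - α) ^ 2)
      (nhdsWithin α {α}ᶜ)
      (nhds (1 / 2 * (deriv (deriv f) α / deriv f α))) := by
  have hfα : ContDiffAt ℝ 2 f α := hf.contDiffAt hs
  have hd : ∀ᶠ x in 𝓝 α, DifferentiableAt ℝ f x :=
    (hfα.eventually (by simp)).mono fun x hx => hx.differentiableAt (by simp)
  have hd2 : DifferentiableAt ℝ (deriv f) α :=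
    (hfα.derivWithin (m := 1) (by norm_num)).differentiableAt (by simp)
  have hderiv : Tendsto (deriv f) (𝓝[≠] α) (𝓝 (deriv f α)) :=
    hd2.continuousAt.tendsto.mono_left nhdsWithin_le_nhds
  have hlim := ((hasDerivAt_iff_tendsto_slope.1 hd2.hasDerivAt).sub
    (tendsto_taylor_two_quotient hd hd2)).div hderiv hf'
  have hval : (deriv (deriv f) α - deriv (deriv f) α / 2) / deriv f α =
      1 / 2 * (deriv (deriv f) α / deriv f α) := by ring
  rw [hval] at hlim
  refine hlim.congr' ?_
  filter_upwards [self_mem_nhdsWithin, hderiv.eventually_ne hf'] with x hx hx'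
  have hxα : x - α ≠ 0 := sub_ne_zero.2 hx
  simp only [Pi.div_apply, slope_def_field, hroot]
  field_simp
  ring
end

section
/- Let m ≥ 2 be a natural number and suppose f : ℝ → ℝ satisfies f(x) = (x - α)^m · h(x) on a neighborhood of α, where h is continuously differentiable near α and h(α) ≠ 0 (α is a root of multiplicity m). Let N(x) = x - f(x)/f'(x) be the Newton iteration map. Then (N(x) - α)/(x - α) tends to 1 - 1/m as x tends to α with x ≠ α; i.e., Newton's method converges only linearly to a multiple root, with asymptotic error constant 1 - 1/m. -/
open Real Filter Topology

/-- Theorem 3.2 (multiple root): at a root `α` of multiplicity `m ≥ 2`, Newton's method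
converges linearly with asymptotic error constant `1 - 1/m`:
`(N(x) - α)/(x - α) → 1 - 1/m` where `N(x) = x - f(x)/f'(x)`. -/
theorem newton_linear_convergence_multiple_root (α : ℝ) (m : ℕ) (hm : 2 ≤ m)
    (f h : ℝ → ℝ) (s : Set ℝ) (hs : s ∈ nhds α)
    (hh : ContDiffOn ℝ 1 h s) (hh0 : h α ≠ 0)
    (hfh : ∀ x ∈ s, f x = (x - α) ^ m * h x) :
    Tendsto (fun x : ℝ => ((x - f x / deriv f x) - α) / (x - α))
      (nhdsWithin α {α}ᶜ)
      (nhds (1 - 1 / (m : ℝ))) := by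
  obtain ⟨n, rfl⟩ : ∃ n, m = n + 1 := ⟨m - 1, by omega⟩
  obtain ⟨u, hus, hu, hαu⟩ := mem_nhds_iff.mp hs
  have hhu : ContDiffOn ℝ 1 h u := hh.mono hus
  have hdc : ContinuousAt (deriv h) α :=
    (hhu.continuousOn_deriv_of_isOpen hu le_rfl).continuousAt (hu.mem_nhds hαu)
  have hhc : ContinuousAt h α := hhu.continuousOn.continuousAt (hu.mem_nhds hαu)
  have hm0 : ((n + 1 : ℕ) : ℝ) ≠ 0 := Nat.cast_ne_zero.mpr n.succ_ne_zero
  have hlim : Tendsto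
      (fun x => 1 - h x / (((n + 1 : ℕ) : ℝ) * h x + (x - α) * deriv h x))
      (𝓝[≠] α) (𝓝 (1 - 1 / ((n + 1 : ℕ) : ℝ))) := by
    have hc : ContinuousAt
        (fun x => 1 - h x / (((n + 1 : ℕ) : ℝ) * h x + (x - α) * deriv h x)) α := by
      refine continuousAt_const.sub (hhc.div ?_ ?_)
      · exact (continuousAt_const.mul hhc).add
          ((continuousAt_id.sub continuousAt_const).mul hdc)
      · simpa using And.intro (by exact_mod_cast hm0) hh0
    have heq : 1 - h α / (((n + 1 : ℕ) : ℝ) * h α + (α - α) * deriv h α) =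
        1 - 1 / ((n + 1 : ℕ) : ℝ) := by
      rw [sub_self, zero_mul, add_zero]
      field_simp
    rw [← heq]
    exact hc.tendsto.mono_left nhdsWithin_le_nhds
  refine hlim.congr' ?_
  filter_upwards [self_mem_nhdsWithin, nhdsWithin_le_nhds (hu.mem_nhds hαu)] with x hx hxu
  have ht : x - α ≠ 0 := sub_ne_zero.mpr hx
  have hxn : u ∈ 𝓝 x := hu.mem_nhds hxu
  have hd : HasDerivAt h (deriv h x) x :=
    ((hhu.contDiffAt hxn).differentiableAt one_ne_zero).hasDerivAt
  have hf : HasDerivAt f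
      ((x - α) ^ n * (((n + 1 : ℕ) : ℝ) * h x + (x - α) * deriv h x)) x := by
    have hp := (((hasDerivAt_id x).sub_const α).pow (n + 1)).mul hd
    refine (hp.congr_of_eventuallyEq ?_).congr_deriv ?_
    · filter_upwards [hxn] with y hy
      simpa using hfh y (hus hy)
    · simp
      ring
  rw [hf.deriv, hfh x (hus hxu), pow_succ, mul_assoc,
    mul_div_mul_left _ _ (pow_ne_zero n ht), mul_div_assoc, sub_right_comm, sub_div,
    div_self ht, mul_div_cancel_left₀ _ ht]
end

section
/- Let q be a nonzero real number, let α > 0, and let f : ℝ → ℝ be twice continuously differentiable on a neighborhood of α with f(α) = 0 and f'(α) ≠ 0. Define the extended Newton (Tsuchikura–Horiguchi) iteration map T(x) = (x^q - q·x^(q-1)·f(x)/f'(x))^(1/q) (real powers). Then (T(x) - α)/(x - α)² tends to (1/2)·(f''(α)/f'(α) + (1-q)/α) as x tends to α through positive values with x ≠ α; i.e., the extended Newton method converges quadratically to a simple root α with asymptotic error constant (1/2)(f''(α)/f'(α) + (1-q)/α). -/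
open Real Filter Topology

/-- Second-order Taylor expansion at a point, in limit form. -/
theorem tendsto_sub_sub_div_sq {g g' : ℝ → ℝ} {a d : ℝ}
    (hg : ∀ᶠ x in 𝓝 a, HasDerivAt g (g' x) x) (hg' : HasDerivAt g' d a) :
    Tendsto (fun x => (g x - g a - g' a * (x - a)) / (x - a) ^ 2) (𝓝[≠] a) (𝓝 (d / 2)) := by
  have hga : ContinuousAt g a := hg.self_of_nhds.continuousAt
  have hne : ∀ᶠ x in 𝓝[≠] a, x ≠ a := eventually_mem_nhdsWithin
  refine HasDerivAt.lhopital_zero_nhdsNE (f' := fun x => g' x - g' a)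
    (g' := fun x => 2 * (x - a)) ?_ ?_ ?_ ?_ ?_ ?_
  · filter_upwards [hg.filter_mono nhdsWithin_le_nhds] with x hx
    simpa using (hx.sub_const (g a)).fun_sub (((hasDerivAt_id x).sub_const a).const_mul (g' a))
  · filter_upwards with x
    simpa using ((hasDerivAt_id x).sub_const a).fun_pow 2
  · filter_upwards [hne] with x hx
    simpa [sub_eq_zero] using hx
  · have h : ContinuousAt (fun x => g x - g a - g' a * (x - a)) a := by fun_prop
    simpa using h.tendsto.mono_left nhdsWithin_le_nhds
  · have h : ContinuousAt (fun x => (x - a) ^ 2) a := by fun_prop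
    simpa using h.tendsto.mono_left nhdsWithin_le_nhds
  · refine (hg'.tendsto_slope.div_const 2).congr fun x => ?_
    rw [slope_def_field, div_div, mul_comm]

/-- The expression `(p x - p a) - p' x * (f x / f' x)` is of second order at a simple root `a`
of `f`. -/
theorem tendsto_sub_mul_div_div_sq {f f' p p' : ℝ → ℝ} {a b d : ℝ}
    (hf : ∀ᶠ x in 𝓝 a, HasDerivAt f (f' x) x) (hf' : HasDerivAt f' b a)
    (hp : ∀ᶠ x in 𝓝 a, HasDerivAt p (p' x) x) (hp' : HasDerivAt p' d a)
    (h0 : f a = 0) (hne : f' a ≠ 0) :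
    Tendsto (fun x => (p x - p' x * (f x / f' x) - p a) / (x - a) ^ 2) (𝓝[≠] a)
      (𝓝 ((p' a * b - f' a * d) / (2 * f' a))) := by
  have hF := tendsto_sub_sub_div_sq hf hf'
  have hP := tendsto_sub_sub_div_sq hp hp'
  have hF' := hf'.tendsto_slope
  have hP' := hp'.tendsto_slope
  have hc : Tendsto f' (𝓝[≠] a) (𝓝 (f' a)) := hf'.continuousAt.tendsto.mono_left nhdsWithin_le_nhds
  have hh : Tendsto (fun x => x - a) (𝓝[≠] a) (𝓝 0) := by
    have h : ContinuousAt (fun x => x - a) a := by fun_prop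
    simpa using h.tendsto.mono_left nhdsWithin_le_nhds
  have key := ((((hF'.const_mul (p' a)).add (hP.const_mul (f' a))).sub
    ((hF.const_mul (p' a)).add (hP'.const_mul (f' a)))).add
    (((hP.mul hF').sub (hP'.mul hF)).mul hh)).div hc hne
  have hlim : (p' a * b + f' a * (d / 2) - (p' a * (b / 2) + f' a * d) +
      (d / 2 * b - d * (b / 2)) * 0) / f' a = (p' a * b - f' a * d) / (2 * f' a) := by
    field_simp
    ring
  rw [hlim] at key
  refine key.congr' ?_
  filter_upwards [hc.eventually_ne hne, eventually_mem_nhdsWithin] with x hx hxa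
  have hxa' : x - a ≠ 0 := sub_ne_zero.2 hxa
  simp only [slope_def_field, h0, Pi.div_apply]
  field_simp
  ring

/-- Theorem 3.3 (simple root, extended Newton method): the extended Newton
(Tsuchikura–Horiguchi) method `T(x) = (x^q - q·x^(q-1)·f(x)/f'(x))^(1/q)` converges
quadratically to a simple root `α > 0` with asymptotic error constant
`(1/2)·(f''(α)/f'(α) + (1-q)/α)`. -/
theorem extended_newton_quadratic_convergence (q α : ℝ) (hq : q ≠ 0) (hα : 0 < α)
    (f : ℝ → ℝ) (s : Set ℝ) (hs : s ∈ nhds α) (hf : ContDiffOn ℝ 2 f s)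
    (hroot : f α = 0) (hf' : deriv f α ≠ 0) :
    Tendsto (fun x : ℝ =>
        ((x ^ q - q * x ^ (q - 1) * (f x / deriv f x)) ^ (1 / q) - α) / (x - α) ^ 2)
      (nhdsWithin α (Set.Ioi 0 \ {α}))
      (nhds (1 / 2 * (deriv (deriv f) α / deriv f α + (1 - q) / α))) := by
  have hmem : interior s ∈ 𝓝 α := interior_mem_nhds.2 hs
  have hfi : ContDiffOn ℝ (1 + 1) f (interior s) := hf.mono interior_subset
  obtain ⟨hd, -, hd'⟩ := (contDiffOn_succ_iff_deriv_of_isOpen isOpen_interior).1 hfi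
  have hf1 : ∀ᶠ x in 𝓝 α, HasDerivAt f (deriv f x) x := by
    filter_upwards [isOpen_interior.mem_nhds (mem_of_mem_nhds hmem)] with x hx
    exact (hd.differentiableAt (isOpen_interior.mem_nhds hx)).hasDerivAt
  have hf2 : HasDerivAt (deriv f) (deriv (deriv f) α) α :=
    ((hd'.differentiableOn one_ne_zero).differentiableAt hmem).hasDerivAt
  have hp1 : ∀ᶠ x in 𝓝 α, HasDerivAt (fun x : ℝ => x ^ q) (q * x ^ (q - 1)) x := by
    filter_upwards [eventually_ne_nhds hα.ne'] with x hx
    exact Real.hasDerivAt_rpow_const (Or.inl hx)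
  have hp2 : HasDerivAt (fun x : ℝ => q * x ^ (q - 1)) (q * ((q - 1) * α ^ (q - 1 - 1))) α :=
    (Real.hasDerivAt_rpow_const (Or.inl hα.ne')).const_mul q
  have hN := tendsto_sub_mul_div_div_sq hf1 hf2 hp1 hp2 hroot hf'
  set N : ℝ → ℝ := fun x => x ^ q - q * x ^ (q - 1) * (f x / deriv f x) with hNdef
  have hαq : 0 < α ^ q := Real.rpow_pos_of_pos hα q
  have hroot_pow : (α ^ q) ^ (1 / q) = α := by
    rw [← Real.rpow_mul hα.le, mul_one_div_cancel hq, Real.rpow_one]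
  have hsq : Tendsto (fun x => (x - α) ^ 2) (𝓝[≠] α) (𝓝 0) := by
    have h : ContinuousAt (fun x => (x - α) ^ 2) α := by fun_prop
    simpa using h.tendsto.mono_left nhdsWithin_le_nhds
  have hNlim : Tendsto N (𝓝[≠] α) (𝓝 (α ^ q)) := by
    have h := (hN.mul hsq).add_const (α ^ q)
    rw [mul_zero, zero_add] at h
    refine h.congr' ?_
    filter_upwards [eventually_mem_nhdsWithin] with x hx
    have hx' : x - α ≠ 0 := sub_ne_zero.2 hx
    simp only [hNdef]
    field_simp
    ring
  have hφ : HasDerivAt (fun t : ℝ => t ^ (1 / q)) (1 / q * (α ^ q) ^ (1 / q - 1)) (α ^ q) :=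
    Real.hasDerivAt_rpow_const (Or.inl hαq.ne')
  have hslope := (continuousAt_dslope_same.2 hφ.differentiableAt).tendsto.comp hNlim
  rw [dslope_same, hφ.deriv] at hslope
  have key := hslope.mul hN
  have hlim : 1 / q * (α ^ q) ^ (1 / q - 1) * ((q * α ^ (q - 1) * deriv (deriv f) α -
      deriv f α * (q * ((q - 1) * α ^ (q - 1 - 1)))) / (2 * deriv f α)) =
      1 / 2 * (deriv (deriv f) α / deriv f α + (1 - q) / α) := by
    rw [Real.rpow_sub_one hαq.ne', hroot_pow, Real.rpow_sub_one hα.ne' (q - 1),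
      Real.rpow_sub_one hα.ne' q]
    field_simp
    ring
  rw [hlim] at key
  refine (key.congr fun x => ?_).mono_left (nhdsWithin_mono α fun x hx => hx.2)
  have h := sub_smul_dslope (fun t : ℝ => t ^ (1 / q)) (α ^ q) (N x)
  simp only [smul_eq_mul, hroot_pow] at h
  rw [← h]
  simp only [Function.comp_apply, hNdef]
  ring
end

section
/- Let q be a nonzero real number, let α > 0, let m ≥ 2 be a natural number, and suppose f : ℝ → ℝ satisfies f(x) = (x - α)^m · h(x) on a neighborhood of α, where h is continuously differentiable near α and h(α) ≠ 0. Define the extended Newton iteration map T(x) = (x^q - q·x^(q-1)·f(x)/f'(x))^(1/q) (real powers). Then (T(x) - α)/(x - α) tends to 1 - 1/m as x tends to α through positive values with x ≠ α; i.e., at a root of multiplicity m the extended Newton method converges linearly with asymptotic error constant 1 - 1/m. -/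
open Real Filter Topology

/-- The product of `x - a` with a function continuous at `a` is differentiable at `a`. -/
theorem hasDerivAt_sub_mul_of_continuousAt {k : ℝ → ℝ} {a : ℝ} (hk : ContinuousAt k a) :
    HasDerivAt (fun x => (x - a) * k x) (k a) a := by
  rw [hasDerivAt_iff_tendsto_slope]
  refine (hk.tendsto.mono_left nhdsWithin_le_nhds).congr' ?_
  filter_upwards [self_mem_nhdsWithin] with x hx
  have hxa : x - a ≠ 0 := sub_ne_zero.mpr hx
  rw [slope_def_field]
  field_simp
  ring

/-- Near a root of multiplicity `m`, the Newton correction `f / f'` is `x - a` times a factor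
with limit `1 / m`. -/
theorem eventually_div_deriv_eq_sub_mul {f h : ℝ → ℝ} {a : ℝ} {m : ℕ} (hm : m ≠ 0)
    (hh : ContDiffAt ℝ 1 h a) (hf : ∀ᶠ x in 𝓝 a, f x = (x - a) ^ m * h x) :
    ∀ᶠ x in 𝓝[≠] a,
      f x / deriv f x = (x - a) * (h x / (m * h x + (x - a) * deriv h x)) := by
  have hdiff : ∀ᶠ x in 𝓝 a, DifferentiableAt ℝ h x :=
    (hh.eventually (by simp)).mono fun x hx => hx.differentiableAt (by simp)
  filter_upwards [hf.eventually_nhds.filter_mono nhdsWithin_le_nhds,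
    hdiff.filter_mono nhdsWithin_le_nhds, self_mem_nhdsWithin] with x hfx hhx hx
  have hxa : x - a ≠ 0 := sub_ne_zero.mpr hx
  obtain ⟨n, rfl⟩ := Nat.exists_eq_succ_of_ne_zero hm
  have hderiv : deriv f x =
      (x - a) ^ n * ((n.succ : ℝ) * h x + (x - a) * deriv h x) := by
    have hpow := (((hasDerivAt_id x).sub_const a).pow n.succ).mul hhx.hasDerivAt
    rw [(hpow.congr_of_eventuallyEq hfx).deriv]
    simp [pow_succ]
    ring
  rw [hderiv, hfx.self_of_nhds, pow_succ, mul_assoc,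
    mul_div_mul_left _ _ (pow_ne_zero n hxa), mul_div_assoc]

/-- Theorem 3.3 (multiple root): at a root `α > 0` of multiplicity `m ≥ 2`, the extended
Newton method `T(x) = (x^q - q·x^(q-1)·f(x)/f'(x))^(1/q)` converges linearly with
asymptotic error constant `1 - 1/m`. -/
theorem extended_newton_linear_convergence_multiple_root (q α : ℝ) (hq : q ≠ 0)
    (hα : 0 < α) (m : ℕ) (hm : 2 ≤ m) (f h : ℝ → ℝ) (s : Set ℝ) (hs : s ∈ nhds α)
    (hh : ContDiffOn ℝ 1 h s) (hh0 : h α ≠ 0)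
    (hfh : ∀ x ∈ s, f x = (x - α) ^ m * h x) :
    Tendsto (fun x : ℝ =>
        ((x ^ q - q * x ^ (q - 1) * (f x / deriv f x)) ^ (1 / q) - α) / (x - α))
      (nhdsWithin α (Set.Ioi 0 \ {α}))
      (nhds (1 - 1 / (m : ℝ))) := by
  have hm0 : m ≠ 0 := by omega
  have hmR : (m : ℝ) ≠ 0 := Nat.cast_ne_zero.mpr hm0
  have hhα : ContDiffAt ℝ 1 h α := hh.contDiffAt hs
  have hquot := eventually_div_deriv_eq_sub_mul hm0 hhα (mem_of_superset hs hfh)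
  have hdc : ContinuousAt (deriv h) α := by
    simpa only [fderiv_apply_one_eq_deriv] using
      (hhα.continuousAt_fderiv one_ne_zero).clm_apply (continuousAt_const (y := (1 : ℝ)))
  have hrpow : ContinuousAt (fun x : ℝ => x ^ (q - 1)) α :=
    continuousAt_rpow_const _ _ (Or.inl hα.ne')
  have hk : ContinuousAt
      (fun x => q * x ^ (q - 1) * (h x / (m * h x + (x - α) * deriv h x))) α := by
    refine (continuousAt_const.mul hrpow).mul (hhα.continuousAt.div ?_ (by simp [hmR, hh0]))
    exact (continuousAt_const.mul hhα.continuousAt).add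
      ((continuousAt_id.sub continuousAt_const).mul hdc)
  have hT := (((hasDerivAt_rpow_const (p := q) (Or.inl hα.ne')).sub
    (hasDerivAt_sub_mul_of_continuousAt hk)).rpow_const (p := 1 / q)
      (Or.inl (by simpa using (rpow_pos_of_pos hα q).ne')))
  have hval : (α ^ q) ^ (1 / q) = α := by
    rw [← rpow_mul hα.le, mul_one_div_cancel hq, rpow_one]
  have hprod : α ^ (q - 1) * (α ^ q) ^ (1 / q - 1) = 1 := by
    rw [← rpow_mul hα.le, ← rpow_add hα,
      show q - 1 + q * (1 / q - 1) = 0 by field_simp; ring, rpow_zero]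
  have hlim := (hasDerivAt_iff_tendsto_slope.mp hT).mono_left
    (nhdsWithin_mono α (fun x (hx : x ∈ Set.Ioi 0 \ {α}) => hx.2))
  convert hlim.congr' ?_ using 2
  · simp only [Pi.sub_apply, sub_self, zero_mul, add_zero, sub_zero]
    have hfac : h α / (m * h α) = 1 / m := by field_simp
    rw [hfac]
    calc 1 - 1 / (m : ℝ)
        = (1 - 1 / m) * (α ^ (q - 1) * (α ^ q) ^ (1 / q - 1)) := by rw [hprod, mul_one]
      _ = _ := by field_simp
  · filter_upwards [hquot.filter_mono
      (nhdsWithin_mono α (fun x (hx : x ∈ Set.Ioi 0 \ {α}) => hx.2))] with x hx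
    rw [slope_def_field, hx]
    simp only [Pi.sub_apply, sub_self, zero_mul, sub_zero, hval]
    congr 3
    ring
end

section
/- Let q be a nonzero real number with q ≠ 1, let α > 0, and let f : ℝ → ℝ be twice differentiable on a neighborhood of α with f'(α) ≠ 0 and f''(α) = 0. Then the curvature of f at α vanishes, μ(α) = f''(α)/(1 + f'(α)²)^(3/2) = 0, while the curvature of g at α^q satisfies |μ_q(α^q)| = |(1-q)·f'(α)/α| / ((q·α^(q-1))²·(1 + (f'(α)/(q·α^(q-1)))²)^(3/2)) > 0; in particular |μ(α)| ≤ |μ_q(α^q)|, where μ_q(α^q) = g''(α^q)/(1 + g'(α^q)²)^(3/2) and g(t) = f(t^(1/q)) for t > 0. -/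
open Real

/-- The derivative of `t ↦ f (t ^ r)` at a positive point. -/
theorem hasDerivAt_comp_rpow {f : ℝ → ℝ} {r t : ℝ} (ht : 0 < t)
    (hf : DifferentiableAt ℝ f (t ^ r)) :
    HasDerivAt (fun x : ℝ => f (x ^ r)) (deriv f (t ^ r) * (r * t ^ (r - 1))) t :=
  hf.hasDerivAt.comp t (Real.hasDerivAt_rpow_const (Or.inl ht.ne'))

/-- The second derivative of `t ↦ f (t ^ r)` at a positive point. -/
theorem deriv_deriv_comp_rpow {f : ℝ → ℝ} {r t : ℝ} (ht : 0 < t)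
    (hf : ∀ᶠ y in nhds (t ^ r), DifferentiableAt ℝ f y)
    (hf2 : DifferentiableAt ℝ (deriv f) (t ^ r)) :
    deriv (deriv (fun x : ℝ => f (x ^ r))) t =
      deriv (deriv f) (t ^ r) * (r * t ^ (r - 1)) ^ 2 +
        deriv f (t ^ r) * (r * ((r - 1) * t ^ (r - 2))) := by
  have hcont : ContinuousAt (fun x : ℝ => x ^ r) t :=
    Real.continuousAt_rpow_const t r (Or.inl ht.ne')
  have heq : deriv (fun x : ℝ => f (x ^ r)) =ᶠ[nhds t]
      fun x => deriv f (x ^ r) * (r * x ^ (r - 1)) := by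
    filter_upwards [hcont.eventually hf, eventually_gt_nhds ht] with x hx hx0
    exact (hasDerivAt_comp_rpow hx0 hx).deriv
  have hpow : HasDerivAt (fun x : ℝ => r * x ^ (r - 1)) (r * ((r - 1) * t ^ (r - 1 - 1))) t :=
    (Real.hasDerivAt_rpow_const (Or.inl ht.ne')).const_mul r
  rw [heq.deriv_eq, ((hasDerivAt_comp_rpow ht hf2).fun_mul hpow).deriv,
    show r - 1 - 1 = r - 2 by ring]
  ring

/-- Theorem 4.2: if `α` is a simple root with `f''(α) = 0`, then the curvature of `f`
at `α` vanishes while the curvature of `g(t) = f(t^(1/q))` at `α^q` is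
`|(1-q)·f'(α)/α| / ((q·α^(q-1))²·(1 + (f'(α)/(q·α^(q-1)))²)^(3/2))` in absolute value
and positive; in particular `|μ(α)| ≤ |μ_q(α^q)|`. -/
theorem curvature_comparison_inflection (q α : ℝ) (hq : q ≠ 0) (hq1 : q ≠ 1)
    (hα : 0 < α) (f : ℝ → ℝ) (s : Set ℝ) (hs : s ∈ nhds α)
    (hf : ∀ y ∈ s, DifferentiableAt ℝ f y)
    (hf2 : ∀ y ∈ s, DifferentiableAt ℝ (deriv f) y)
    (hf' : deriv f α ≠ 0) (hf'' : deriv (deriv f) α = 0) :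
    deriv (deriv f) α / (1 + (deriv f α) ^ 2) ^ ((3 : ℝ) / 2) = 0 ∧
    |deriv (deriv (fun t : ℝ => f (t ^ (1 / q)))) (α ^ q) /
        (1 + (deriv (fun t : ℝ => f (t ^ (1 / q))) (α ^ q)) ^ 2) ^ ((3 : ℝ) / 2)| =
      |(1 - q) * deriv f α / α| /
        ((q * α ^ (q - 1)) ^ 2 *
          (1 + (deriv f α / (q * α ^ (q - 1))) ^ 2) ^ ((3 : ℝ) / 2)) ∧
    0 < |deriv (deriv (fun t : ℝ => f (t ^ (1 / q)))) (α ^ q) /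
        (1 + (deriv (fun t : ℝ => f (t ^ (1 / q))) (α ^ q)) ^ 2) ^ ((3 : ℝ) / 2)| ∧
    |deriv (deriv f) α / (1 + (deriv f α) ^ 2) ^ ((3 : ℝ) / 2)| ≤
      |deriv (deriv (fun t : ℝ => f (t ^ (1 / q)))) (α ^ q) /
        (1 + (deriv (fun t : ℝ => f (t ^ (1 / q))) (α ^ q)) ^ 2) ^ ((3 : ℝ) / 2)| := by
  have hp : 0 < α ^ q := Real.rpow_pos_of_pos hα q
  have hr : (α ^ q) ^ (1 / q) = α := by
    rw [← Real.rpow_mul hα.le, mul_one_div_cancel hq, Real.rpow_one]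
  have hr1 : (α ^ q) ^ (1 / q - 1) = α / α ^ q := by
    rw [Real.rpow_sub_one hp.ne', hr]
  have hr2 : (α ^ q) ^ (1 / q - 2) = α / (α ^ q) ^ 2 := by
    rw [Real.rpow_sub hp, hr, Real.rpow_two]
  have hq1' : α ^ (q - 1) = α ^ q / α := Real.rpow_sub_one hα.ne' q
  have hd : deriv (fun t : ℝ => f (t ^ (1 / q))) (α ^ q) =
      deriv f α / (q * α ^ (q - 1)) := by
    have h := (hasDerivAt_comp_rpow (f := f) (r := 1 / q) hp
      (by rw [hr]; exact hf α (mem_of_mem_nhds hs))).deriv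
    rw [h, hr, hr1, hq1']
    field_simp
  have hdd : deriv (deriv (fun t : ℝ => f (t ^ (1 / q)))) (α ^ q) =
      (1 - q) * deriv f α / α / (q * α ^ (q - 1)) ^ 2 := by
    rw [deriv_deriv_comp_rpow hp (by rw [hr]; exact Filter.mem_of_superset hs hf)
      (by rw [hr]; exact hf2 α (mem_of_mem_nhds hs)), hr, hf'', hr2, hq1']
    field_simp
    ring
  have hc2 : 0 < (q * α ^ (q - 1)) ^ 2 := by positivity
  have hK : 0 < (1 + (deriv f α / (q * α ^ (q - 1))) ^ 2) ^ ((3 : ℝ) / 2) := by positivity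
  have hzero : deriv (deriv f) α / (1 + (deriv f α) ^ 2) ^ ((3 : ℝ) / 2) = 0 := by
    rw [hf'', zero_div]
  have hnum : (1 - q) * deriv f α / α ≠ 0 :=
    div_ne_zero (mul_ne_zero (sub_ne_zero.mpr hq1.symm) hf') hα.ne'
  refine ⟨hzero, ?_, ?_, ?_⟩
  · rw [hdd, hd, div_div, abs_div, abs_of_pos (mul_pos hc2 hK)]
  · rw [hdd, hd, abs_pos]
    exact div_ne_zero (div_ne_zero hnum hc2.ne') hK.ne'
  · rw [hzero, abs_zero]
    exact abs_nonneg _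
end

section
/- Let q be a nonzero real number, let x > 0, and let f : ℝ → ℝ be twice differentiable on a neighborhood of x with f''(x) ≠ 0. Then g''(x^q) and f''(x) have the same sign (i.e., g''(x^q)·f''(x) > 0) if and only if 1 + (f'(x)/f''(x))·(1-q)/x > 0, and they have opposite signs (g''(x^q)·f''(x) < 0) if and only if 1 + (f'(x)/f''(x))·(1-q)/x < 0, where g(t) = f(t^(1/q)) for t > 0. -/
/-- Second derivative of `t ↦ f (t ^ p)` at a positive point. -/
theorem hasDerivAt_deriv_comp_rpow {f : ℝ → ℝ} {p t : ℝ} (ht : 0 < t)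
    (hf : ∀ᶠ y in nhds (t ^ p), DifferentiableAt ℝ f y)
    (hf2 : DifferentiableAt ℝ (deriv f) (t ^ p)) :
    HasDerivAt (deriv (fun u : ℝ => f (u ^ p)))
      (deriv (deriv f) (t ^ p) * (p * t ^ (p - 1)) * (p * t ^ (p - 1)) +
        deriv f (t ^ p) * (p * ((p - 1) * t ^ (p - 1 - 1)))) t := by
  have hpow : HasDerivAt (fun u : ℝ => u ^ p) (p * t ^ (p - 1)) t :=
    Real.hasDerivAt_rpow_const (Or.inl ht.ne')
  have hfirst : deriv (fun u : ℝ => f (u ^ p)) =ᶠ[nhds t]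
      fun u => deriv f (u ^ p) * (p * u ^ (p - 1)) := by
    filter_upwards [hpow.continuousAt.eventually hf, eventually_gt_nhds ht] with u hu hu0
    exact (hu.hasDerivAt.comp u (Real.hasDerivAt_rpow_const (Or.inl hu0.ne'))).deriv
  have hpow' : HasDerivAt (fun u : ℝ => p * u ^ (p - 1)) (p * ((p - 1) * t ^ (p - 1 - 1))) t :=
    (Real.hasDerivAt_rpow_const (Or.inl ht.ne')).const_mul p
  exact ((hf2.hasDerivAt.comp t hpow).mul hpow').congr_of_eventuallyEq hfirst


open Real

/-- Lemma 4.3: `g''(x^q)` and `f''(x)` have the same sign iff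
`1 + (f'(x)/f''(x))·(1-q)/x > 0`, and opposite signs iff that quantity is `< 0`,
where `g(t) = f(t^(1/q))`. -/
theorem second_deriv_sign_comparison (q x : ℝ) (hq : q ≠ 0) (hx : 0 < x)
    (f : ℝ → ℝ) (s : Set ℝ) (hs : s ∈ nhds x)
    (hf : ∀ y ∈ s, DifferentiableAt ℝ f y)
    (hf2 : ∀ y ∈ s, DifferentiableAt ℝ (deriv f) y)
    (hfxx : deriv (deriv f) x ≠ 0) :
    (0 < deriv (deriv (fun t : ℝ => f (t ^ (1 / q)))) (x ^ q) * deriv (deriv f) x ↔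
      0 < 1 + deriv f x / deriv (deriv f) x * ((1 - q) / x)) ∧
    (deriv (deriv (fun t : ℝ => f (t ^ (1 / q)))) (x ^ q) * deriv (deriv f) x < 0 ↔
      1 + deriv f x / deriv (deriv f) x * ((1 - q) / x) < 0) := by
  have ht : 0 < x ^ q := Real.rpow_pos_of_pos hx q
  have hroot : (x ^ q) ^ (1 / q) = x := by
    rw [← Real.rpow_mul hx.le, mul_one_div_cancel hq, Real.rpow_one]
  have hsecond := (hasDerivAt_deriv_comp_rpow (f := f) (p := 1 / q) ht
    (by rw [hroot]; exact Filter.mem_of_superset hs hf)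
    (by rw [hroot]; exact hf2 x (mem_of_mem_nhds hs))).deriv
  rw [Real.rpow_sub_one ht.ne' (1 / q - 1), Real.rpow_sub_one ht.ne' (1 / q), hroot] at hsecond
  have hfactor : deriv (deriv (fun t : ℝ => f (t ^ (1 / q)))) (x ^ q) * deriv (deriv f) x =
      (x * deriv (deriv f) x / (q * x ^ q)) ^ 2 *
        (1 + deriv f x / deriv (deriv f) x * ((1 - q) / x)) := by
    rw [hsecond]
    generalize x ^ q = t at ht
    field_simp
  have hpos : 0 < (x * deriv (deriv f) x / (q * x ^ q)) ^ 2 := by positivity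
  rw [hfactor]
  exact ⟨mul_pos_iff_of_pos_left hpos,
    fun h => neg_of_mul_neg_right h hpos.le, mul_neg_of_pos_of_neg hpos⟩
end

section
/- Let q be a nonzero real number, let α > 0, and let f : ℝ → ℝ be twice differentiable on a neighborhood of α with f'(α) ≠ 0 and f''(α) ≠ 0, and set g(t) = f(t^(1/q)) for t > 0. Then -|f''(α)|/(q·α^(q-1))² ≤ g''(α^q) ≤ |f''(α)|/(q·α^(q-1))² holds if and only if |1 + (f'(α)/f''(α))·(1-q)/α| ≤ 1 (equivalently, 0 ≤ (f'(α)/f''(α))·(q-1)/α ≤ 2). -/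
open Real

open Filter Topology in
theorem hasDerivAt_deriv_comp_rpow_const {f : ℝ → ℝ} {p t : ℝ} (ht : 0 < t)
    (hf : ∀ᶠ y in 𝓝 (t ^ p), DifferentiableAt ℝ f y)
    (hf2 : DifferentiableAt ℝ (deriv f) (t ^ p)) :
    HasDerivAt (deriv fun x : ℝ => f (x ^ p))
      (deriv (deriv f) (t ^ p) * (p * t ^ (p - 1)) * (p * t ^ (p - 1)) +
        deriv f (t ^ p) * (p * ((p - 1) * t ^ (p - 1 - 1)))) t := by
  have hpow : ∀ (r : ℝ) {x : ℝ}, 0 < x → HasDerivAt (fun y : ℝ => y ^ r) (r * x ^ (r - 1)) x :=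
    fun r x hx => Real.hasDerivAt_rpow_const (Or.inl hx.ne')
  have hfirst : (deriv fun x : ℝ => f (x ^ p)) =ᶠ[𝓝 t]
      fun x => deriv f (x ^ p) * (p * x ^ (p - 1)) := by
    filter_upwards [(hpow p ht).continuousAt.eventually hf, lt_mem_nhds ht] with x hx hx0
    exact (hx.hasDerivAt.comp x (hpow p hx0)).deriv
  refine HasDerivAt.congr_of_eventuallyEq ?_ hfirst
  exact (hf2.hasDerivAt.comp t (hpow p ht)).mul ((hpow (p - 1) ht).const_mul p)

open Filter Topology in
theorem deriv_deriv_comp_rpow_one_div {f : ℝ → ℝ} {q a : ℝ} (hq : q ≠ 0) (ha : 0 < a)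
    (hf : ∀ᶠ y in 𝓝 a, DifferentiableAt ℝ f y) (hf2 : DifferentiableAt ℝ (deriv f) a) :
    deriv (deriv fun t : ℝ => f (t ^ (1 / q))) (a ^ q) =
      (deriv (deriv f) a + deriv f a * ((1 - q) / a)) / (q * a ^ (q - 1)) ^ 2 := by
  have hroot : (a ^ q) ^ (1 / q) = a := by
    rw [← Real.rpow_mul ha.le, mul_one_div_cancel hq, Real.rpow_one]
  have hroot1 : (a ^ q) ^ (1 / q - 1) = a / a ^ q := by
    rw [Real.rpow_sub_one (Real.rpow_pos_of_pos ha q).ne', hroot]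
  have hroot2 : (a ^ q) ^ (1 / q - 1 - 1) = a / a ^ q / a ^ q := by
    rw [Real.rpow_sub_one (Real.rpow_pos_of_pos ha q).ne', hroot1]
  have h := (hasDerivAt_deriv_comp_rpow_const (f := f) (p := 1 / q)
    (Real.rpow_pos_of_pos ha q) (by rwa [hroot]) (by rwa [hroot])).deriv
  rw [h, hroot, hroot1, hroot2, Real.rpow_sub_one ha.ne']
  have hpos := (Real.rpow_pos_of_pos ha q).ne'
  field_simp

/-- Theorem 4.5: `-|f''(α)|/(q·α^(q-1))² ≤ g''(α^q) ≤ |f''(α)|/(q·α^(q-1))²` holds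
iff `|1 + (f'(α)/f''(α))·(1-q)/α| ≤ 1`, equivalently
`0 ≤ (f'(α)/f''(α))·(q-1)/α ≤ 2`, where `g(t) = f(t^(1/q))`. -/
theorem second_deriv_bound_comparison (q α : ℝ) (hq : q ≠ 0) (hα : 0 < α)
    (f : ℝ → ℝ) (s : Set ℝ) (hs : s ∈ nhds α)
    (hf : ∀ y ∈ s, DifferentiableAt ℝ f y)
    (hf2 : ∀ y ∈ s, DifferentiableAt ℝ (deriv f) y)
    (hf' : deriv f α ≠ 0) (hf'' : deriv (deriv f) α ≠ 0) :
    ((-(|deriv (deriv f) α| / (q * α ^ (q - 1)) ^ 2) ≤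
          deriv (deriv (fun t : ℝ => f (t ^ (1 / q)))) (α ^ q) ∧
        deriv (deriv (fun t : ℝ => f (t ^ (1 / q)))) (α ^ q) ≤
          |deriv (deriv f) α| / (q * α ^ (q - 1)) ^ 2) ↔
      |1 + deriv f α / deriv (deriv f) α * ((1 - q) / α)| ≤ 1) ∧
    (|1 + deriv f α / deriv (deriv f) α * ((1 - q) / α)| ≤ 1 ↔
      0 ≤ deriv f α / deriv (deriv f) α * ((q - 1) / α) ∧
        deriv f α / deriv (deriv f) α * ((q - 1) / α) ≤ 2) := by
  constructor
  · have hg := deriv_deriv_comp_rpow_one_div hq hα (Filter.mem_of_superset hs hf)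
      (hf2 α (mem_of_mem_nhds hs))
    have hfactor : deriv (deriv f) α + deriv f α * ((1 - q) / α) =
        deriv (deriv f) α * (1 + deriv f α / deriv (deriv f) α * ((1 - q) / α)) := by
      field_simp
    have hden : 0 < (q * α ^ (q - 1)) ^ 2 := by
      have := Real.rpow_pos_of_pos hα (q - 1)
      positivity
    rw [← abs_le, hg, hfactor, abs_div, abs_of_pos hden, div_le_div_iff_of_pos_right hden,
      abs_mul, mul_le_iff_le_one_right (abs_pos.mpr hf'')]
  · have hneg : deriv f α / deriv (deriv f) α * ((1 - q) / α) =
        -(deriv f α / deriv (deriv f) α * ((q - 1) / α)) := by ring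
    rw [hneg, abs_le]
    constructor <;> rintro ⟨h₁, h₂⟩ <;> constructor <;> linarith
end
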